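/- arXiv:2506.08904 — 3 statements merged into one kernel-verified Lean document; each statement's English description precedes it below -/
import Mathlib

section
/- Let G be a finite group, N a normal subgroup of G, and p a prime that does not divide the index [G : N]. If the order of Out_c(N) ∩ Out_Col(N) is not divisible by p, then the order of Out_c(G) ∩ Out_Col(G) is not divisible by p. -/
/-- A finite 2-group of order `2^n` (`n ≥ 4`) is semidihedral if it is generated by
elements `a`, `b` with `a^(2^(n-1)) = 1`, `b^2 = 1` and `b⁻¹ * a * b = a^(2^(n-2) - 1)`. -/
def IsSemidihedral (S : Type*) [Group S] : Prop :=
  ∃ n : ℕ, 4 ≤ n ∧ Nat.card S = 2 ^ n ∧ ∃ a b : S,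
    a ^ (2 ^ (n - 1)) = 1 ∧ b ^ 2 = 1 ∧ b⁻¹ * a * b = a ^ (2 ^ (n - 2) - 1) ∧
    Subgroup.closure {a, b} = ⊤

/-- An automorphism is class-preserving if it maps every element to a conjugate of itself. -/
def IsClassPres {G : Type*} [Group G] (φ : MulAut G) : Prop :=
  ∀ g : G, IsConj g (φ g)

/-- An automorphism is Coleman if its restriction to every Sylow subgroup is given by
conjugation by some element of the group. -/
def IsColemanAut {G : Type*} [Group G] (φ : MulAut G) : Prop :=
  ∀ p : ℕ, p.Prime → ∀ P : Sylow p G, ∃ x : G, ∀ u ∈ (P : Subgroup G), φ u = x⁻¹ * u * x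

/-- An automorphism is inner if it is conjugation by some group element. -/
def IsInnerAut {G : Type*} [Group G] (φ : MulAut G) : Prop :=
  ∃ g : G, φ = MulAut.conj g

/-- The subgroup of inner automorphisms. -/
def InnAut (G : Type*) [Group G] : Subgroup (MulAut G) := (MulAut.conj : G →* MulAut G).range

/-- The subset `Out_c(G) ∩ Out_Col(G)` of `Out(G) = Aut(G)/Inn(G)`: the classes of
automorphisms that are simultaneously class-preserving and Coleman. -/
def OutCCol (G : Type*) [Group G] : Set (MulAut G ⧸ InnAut G) :=
  {q | ∃ φ : MulAut G, IsClassPres φ ∧ IsColemanAut φ ∧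
    (QuotientGroup.mk φ : MulAut G ⧸ InnAut G) = q}

/-- A subgroup of a finite group that meets every conjugacy class is the whole group. -/
theorem Subgroup.eq_top_of_forall_exists_conj_mem {Q : Type*} [Group Q] [Finite Q]
    (H : Subgroup Q) (hH : ∀ g : Q, ∃ x : Q, x⁻¹ * g * x ∈ H) : H = ⊤ := by
  classical
  have := Fintype.ofFinite Q
  have burnside := MulAction.sum_card_fixedBy_eq_card_orbits_mul_card_group Q (Q ⧸ H)
  have orbits : Fintype.card (MulAction.orbitRel.Quotient Q (Q ⧸ H)) = 1 := by
    rw [Fintype.card_eq_one_iff_nonempty_unique]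
    have := (MulAction.pretransitive_iff_subsingleton_quotient Q (Q ⧸ H)).1 inferInstance
    exact ⟨⟨⟨Quotient.mk _ ((1 : Q) : Q ⧸ H)⟩, fun _ => Subsingleton.elim _ _⟩⟩
  have fixed_pos : ∀ g : Q, 1 ≤ Fintype.card (MulAction.fixedBy (Q ⧸ H) g) := by
    intro g
    obtain ⟨x, hx⟩ := hH g
    refine Fintype.card_pos_iff.2 ⟨⟨(x : Q ⧸ H), ?_⟩⟩
    exact (QuotientGroup.eq.2 (by simpa [mul_assoc] using hx)).symm
  rw [orbits, one_mul, Fintype.card_eq_sum_ones] at burnside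
  have fixed_one := (Finset.sum_eq_sum_iff_of_le fun g _ => fixed_pos g).1 burnside.symm 1
    (Finset.mem_univ _)
  rw [← Subgroup.index_eq_one, Subgroup.index, Nat.card_eq_fintype_card]
  rw [fixed_one]
  exact Fintype.card_congr (Equiv.symm (Equiv.subtypeUnivEquiv fun x => one_smul Q x))

/-- A class-preserving endomorphism of `p`-power order of a finite `p'`-group is trivial. -/
theorem MonoidHom.eq_self_of_isConj_of_iterate {Q : Type*} [Group Q] [Finite Q] {p k : ℕ}
    (hp : p.Prime) (hQ : ¬ p ∣ Nat.card Q) (ψ : Q →* Q) (hψ : ∀ g, IsConj g (ψ g))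
    (hk : ∀ g, ψ^[p ^ k] g = g) (g : Q) : ψ g = g := by
  classical
  have := Fintype.ofFinite Q
  have := Fact.mk hp
  suffices h : ψ.eqLocus (MonoidHom.id Q) = ⊤ by
    have hg : g ∈ ψ.eqLocus (MonoidHom.id Q) := h ▸ Subgroup.mem_top g
    exact hg
  refine Subgroup.eq_top_of_forall_exists_conj_mem _ fun g => ?_
  let α := MulAction.orbit (ConjAct Q) g
  let f : Function.End α := fun a => ⟨ψ a, ConjAct.mem_orbit_conjAct.2
    ((hψ a).symm.trans (ConjAct.mem_orbit_conjAct.1 a.2))⟩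
  have hf : ∀ n : ℕ, ∀ a : α, ((f ^ n) a : Q) = ψ^[n] a := by
    intro n
    induction n with
    | zero => exact fun a => rfl
    | succ n ih =>
      intro a
      rw [pow_succ, Function.iterate_succ_apply]
      exact ih (f a)
  have hmod := Equiv.Perm.card_fixedPoints_modEq (f := f) (p := p) (n := k)
    (funext fun a => Subtype.ext ((hf _ a).trans (hk a)))
  have hα : ¬ p ∣ Fintype.card α := fun hdvd => hQ <| by
    have := Subgroup.index_dvd_card (MulAction.stabilizer (ConjAct Q) g)
    rw [MulAction.index_stabilizer, ← Nat.card_coe_set_eq] at this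
    exact (Nat.card_eq_fintype_card (α := α) ▸ hdvd).trans this
  have hpos : 0 < Fintype.card f.fixedPoints := by
    refine Nat.pos_of_ne_zero fun h0 => hα ?_
    rw [h0] at hmod
    exact (Nat.modEq_zero_iff_dvd).1 hmod
  obtain ⟨⟨⟨a, ha⟩, hfix⟩⟩ := Fintype.card_pos_iff.1 hpos
  obtain ⟨x, rfl⟩ := isConj_iff.1 (ConjAct.mem_orbit_conjAct.1 ha).symm
  refine ⟨x⁻¹, ?_⟩
  rw [inv_inv]
  exact congrArg Subtype.val hfix

instance InnAut.normal (G : Type*) [Group G] : (InnAut G).Normal where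
  conj_mem := by
    rintro _ ⟨g, rfl⟩ φ
    exact ⟨φ g, by ext; simp⟩

/-- The group of class-preserving Coleman automorphisms. -/
def classPresColemanAut (G : Type*) [Group G] : Subgroup (MulAut G) where
  carrier := {φ | IsClassPres φ ∧ IsColemanAut φ}
  one_mem' := ⟨fun g => IsConj.refl g, fun _ _ _ => ⟨1, by simp⟩⟩
  mul_mem' := by
    rintro φ ψ ⟨hφ, hφ'⟩ ⟨hψ, hψ'⟩
    refine ⟨fun g => (hψ g).trans (hφ (ψ g)), fun q hq P => ?_⟩
    obtain ⟨x, hx⟩ := hφ' q hq P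
    obtain ⟨y, hy⟩ := hψ' q hq P
    exact ⟨x * φ y, fun u hu => by simp [hx u hu, hy u hu, mul_assoc]⟩
  inv_mem' := by
    rintro φ ⟨hφ, hφ'⟩
    refine ⟨fun g => ?_, fun q hq P => ?_⟩
    · simpa using (hφ (φ⁻¹ g)).symm
    · obtain ⟨x, hx⟩ := hφ' q hq P
      refine ⟨(φ⁻¹ x)⁻¹, fun u hu => φ.injective ?_⟩
      simp [hx u hu, mul_assoc]

theorem OutCCol_eq_map (G : Type*) [Group G] :
    OutCCol G = ((classPresColemanAut G).map (QuotientGroup.mk' (InnAut G)) : Set _) := by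
  ext q
  exact ⟨fun ⟨φ, h, h', hq⟩ => ⟨φ, ⟨h, h'⟩, hq⟩, fun ⟨φ, ⟨h, h'⟩, hq⟩ => ⟨φ, h, h', hq⟩⟩

theorem InnAut_le_classPresColemanAut (G : Type*) [Group G] :
    InnAut G ≤ classPresColemanAut G := by
  rintro _ ⟨g, rfl⟩
  exact ⟨fun u => isConj_iff.2 ⟨g, rfl⟩, fun _ _ _ => ⟨g⁻¹, fun u _ => by simp⟩⟩

/-- `p` does not divide `|Out_c(G) ∩ Out_Col(G)|` iff every class-preserving Coleman automorphism
of `G` has an inner power with exponent prime to `p`. -/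
theorem not_dvd_card_OutCCol_iff {G : Type*} [Group G] [Finite G] {p : ℕ} (hp : p.Prime) :
    ¬ p ∣ Nat.card (OutCCol G) ↔
      ∀ φ ∈ classPresColemanAut G, ∃ m : ℕ, ¬ p ∣ m ∧ φ ^ m ∈ InnAut G := by
  have := Fact.mk hp
  rw [OutCCol_eq_map]
  constructor
  · intro h φ hφ
    refine ⟨_, h, (QuotientGroup.eq_one_iff _).1 ?_⟩
    have := pow_card_eq_one' (x := (⟨QuotientGroup.mk' (InnAut G) φ, φ, hφ, rfl⟩ :
      (classPresColemanAut G).map (QuotientGroup.mk' (InnAut G))))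
    exact congrArg Subtype.val this
  · intro h hdvd
    obtain ⟨⟨_, φ, hφ, rfl⟩, hord⟩ := exists_prime_orderOf_dvd_card'
      (G := (classPresColemanAut G).map (QuotientGroup.mk' (InnAut G))) p hdvd
    obtain ⟨m, hm, hinn⟩ := h φ hφ
    refine hm (hord ▸ orderOf_dvd_of_pow_eq_one (Subtype.ext ?_))
    exact (QuotientGroup.eq_one_iff (φ ^ m)).2 hinn

section Restriction

variable {G : Type*} [Group G] {N : Subgroup G}

theorem IsClassPres.apply_mem [N.Normal] {φ : MulAut G} (hφ : IsClassPres φ) {n : G}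
    (hn : n ∈ N) : φ n ∈ N := by
  obtain ⟨x, hx⟩ := isConj_iff.1 (hφ n)
  exact hx ▸ Subgroup.Normal.conj_mem inferInstance n hn x

/-- The restriction of a class-preserving automorphism to a normal subgroup. -/
def IsClassPres.restrict [N.Normal] {φ : MulAut G} (hφ : IsClassPres φ) : MulAut N where
  toFun n := ⟨φ n, hφ.apply_mem n.2⟩
  invFun n := ⟨φ⁻¹ n, IsClassPres.apply_mem (φ := φ⁻¹)
    (fun g => by simpa using (hφ (φ⁻¹ g)).symm) n.2⟩
  left_inv n := Subtype.ext (by simp)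
  right_inv n := Subtype.ext (by simp)
  map_mul' a b := Subtype.ext (by simp)

@[simp]
theorem IsClassPres.coe_restrict_pow_apply [N.Normal] {φ : MulAut G} (hφ : IsClassPres φ)
    (k : ℕ) (n : N) : ((hφ.restrict ^ k) n : G) = (φ ^ k) n := by
  induction k generalizing n with
  | zero => rfl
  | succ k ih =>
    rw [pow_succ, pow_succ, MulAut.mul_apply, ih]
    rfl

theorem IsClassPres.inv_mul_apply_mem [Finite G] [N.Normal] {p k : ℕ} (hp : p.Prime)
    (hind : ¬ p ∣ N.index) {φ : MulAut G} (hφ : IsClassPres φ) (hk : φ ^ p ^ k = 1) (g : G) :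
    g⁻¹ * φ g ∈ N := by
  let ψ : G ⧸ N →* G ⧸ N := QuotientGroup.map N N φ.toMonoidHom fun n hn => hφ.apply_mem hn
  have hψ : ∀ j : ℕ, ∀ g : G, ψ^[j] (g : G ⧸ N) = ((φ ^ j) g : G) := by
    intro j
    induction j with
    | zero => exact fun g => rfl
    | succ j ih =>
      intro g
      rw [Function.iterate_succ_apply, pow_succ]
      exact ih (φ g)
  refine QuotientGroup.eq.1 (MonoidHom.eq_self_of_isConj_of_iterate (k := k) hp hind ψ ?_ ?_
    (g : G ⧸ N)).symm
  · intro x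
    induction x using QuotientGroup.induction_on with
    | H x => exact MonoidHom.map_isConj (QuotientGroup.mk' N) (hφ x)
  · intro x
    induction x using QuotientGroup.induction_on with
    | H x => rw [hψ, hk]; rfl

/-- If an automorphism of `p`-power order that is trivial modulo `N` acts on a family of elements
as conjugation by an element of `G`, and `p` does not divide `[G : N]`, then it acts on this
family as conjugation by an element of `N`. -/
theorem exists_mem_conj_of_exists_conj [Finite G] [N.Normal] {p k : ℕ} (hp : p.Prime)
    (hind : ¬ p ∣ N.index) {φ : MulAut G} (hφ : ∀ g, g⁻¹ * φ g ∈ N) (hk : φ ^ p ^ k = 1)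
    {ι : Type*} (f : ι → G) {x : G} (hx : ∀ i, φ (f i) = x⁻¹ * f i * x) :
    ∃ n ∈ N, ∀ i, φ (f i) = n⁻¹ * f i * n := by
  have hpow : ∀ j : ℕ, ∃ y : G, (y : G ⧸ N) = (x : G ⧸ N) ^ j ∧
      ∀ i, (φ ^ j) (f i) = y⁻¹ * f i * y := by
    intro j
    induction j with
    | zero => exact ⟨1, by simp⟩
    | succ j ih =>
      obtain ⟨y, hy, hfy⟩ := ih
      refine ⟨x * φ y, ?_, fun i => ?_⟩
      · rw [pow_succ', ← hy, QuotientGroup.mk_mul, QuotientGroup.eq.2 (hφ y)]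
      · rw [pow_succ', MulAut.mul_apply, hfy]
        simp [hx, mul_assoc]
  obtain ⟨y, hy, hfy⟩ := hpow (p ^ k)
  have hcop : (p ^ k).Coprime (orderOf (x : G ⧸ N)) :=
    Nat.Coprime.pow_left k <| (Nat.Prime.coprime_iff_not_dvd hp).2 fun h =>
      hind (h.trans (orderOf_dvd_natCard _))
  obtain ⟨a, ha⟩ := exists_pow_eq_self_of_coprime hcop
  have hcomm : ∀ i, Commute (y ^ a) (f i) := fun i => Commute.pow_left (by
    have := hfy i
    rw [hk, MulAut.one_apply, mul_assoc, eq_inv_mul_iff_mul_eq] at this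
    exact this) a
  refine ⟨(y ^ a)⁻¹ * x, QuotientGroup.eq.1 (by rw [QuotientGroup.mk_pow, hy, ha]), fun i => ?_⟩
  rw [hx, mul_inv_rev, inv_inv, mul_assoc x⁻¹ (y ^ a), (hcomm i).eq]
  simp [mul_assoc]

theorem IsClassPres.restrict_mem_classPresColemanAut [Finite G] [N.Normal] {p k : ℕ}
    (hp : p.Prime) (hind : ¬ p ∣ N.index) {φ : MulAut G} (hφ : IsClassPres φ)
    (hφ' : IsColemanAut φ) (hk : φ ^ p ^ k = 1) :
    (hφ.restrict : MulAut N) ∈ classPresColemanAut N := by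
  have hN := hφ.inv_mul_apply_mem hp hind hk
  refine ⟨fun n => ?_, fun q hq P => ?_⟩
  · obtain ⟨x, hx⟩ := isConj_iff.1 (hφ n)
    obtain ⟨m, hm, hfm⟩ := exists_mem_conj_of_exists_conj hp hind hN hk
      (fun _ : Unit => (n : G)) (x := x⁻¹) (fun _ => by simp [hx])
    exact isConj_iff.2 ⟨⟨m, hm⟩⁻¹, Subtype.ext (by
      simpa [IsClassPres.restrict] using (hfm ()).symm)⟩
  · obtain ⟨S, hS⟩ := (P.isPGroup'.map N.subtype).exists_le_sylow
    obtain ⟨x, hx⟩ := hφ' q hq S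
    obtain ⟨m, hm, hfm⟩ := exists_mem_conj_of_exists_conj hp hind hN hk
      (fun u : (P : Subgroup N) => ((u : N) : G)) (x := x)
      (fun u => hx _ (hS ⟨u, u.2, rfl⟩))
    exact ⟨⟨m, hm⟩, fun u hu => Subtype.ext (hfm ⟨u, hu⟩)⟩

open scoped IsMulCommutative in
/-- An automorphism of `p`-power order that is trivial on `N` and modulo `N`, where `p` does not
divide `[G : N]`, is inner. -/
theorem mem_InnAut_of_trivial_on_of_trivial_mod [Finite G] [N.Normal] {p k : ℕ} (hp : p.Prime)
    (hind : ¬ p ∣ N.index) {φ : MulAut G} (hk : φ ^ p ^ k = 1)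
    (hmod : ∀ g, g⁻¹ * φ g ∈ N) (hN : ∀ n ∈ N, φ n = n) : φ ∈ InnAut G := by
  classical
  have := Fintype.ofFinite (G ⧸ N)
  have hcentral : ∀ g, ∀ n ∈ N, n * (g⁻¹ * φ g) = g⁻¹ * φ g * n := by
    intro g n hn
    have h := hN _ (Subgroup.Normal.conj_mem inferInstance n hn g)
    rw [map_mul, map_mul, hN n hn, map_inv, mul_inv_eq_iff_eq_mul] at h
    rw [mul_assoc, h]
    group
  let z : G → Subgroup.center N := fun g => ⟨⟨g⁻¹ * φ g, hmod g⟩,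
    Subgroup.mem_center_iff.2 fun n => Subtype.ext (hcentral g n n.2)⟩
  have hz : ∀ g, φ g = g * (z g : N) := fun g => by simp [z]
  have hzfix : ∀ g, φ (z g : N) = (z g : N) := fun g => hN _ (z g : N).2
  have hzpow : ∀ g, z g ^ p ^ k = 1 := by
    intro g
    have h : ∀ j : ℕ, (φ ^ j) g = g * ((z g : N) : G) ^ j := by
      intro j
      induction j with
      | zero => simp
      | succ j ih => rw [pow_succ', MulAut.mul_apply, ih, map_mul, map_pow, hzfix, hz,
          mul_assoc, ← pow_succ']
    have h1 := h (p ^ k)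
    rw [hk, MulAut.one_apply, left_eq_mul] at h1
    exact Subtype.ext (Subtype.ext (by simpa using h1))
  let conjZ : G → Subgroup.center N →* Subgroup.center N := fun h =>
    { toFun := fun c => ⟨⟨h⁻¹ * (c : N) * h, by
        simpa using Subgroup.Normal.conj_mem (inferInstance : N.Normal) _ (c : N).2 h⁻¹⟩,
        Subgroup.mem_center_iff.2 fun n => Subtype.ext (by
          have hn : h * n * h⁻¹ ∈ N := Subgroup.Normal.conj_mem inferInstance _ n.2 h
          have hc := congrArg Subtype.val (Subgroup.mem_center_iff.1 c.2 ⟨_, hn⟩)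
          have hc' : h * n * h⁻¹ * (c : N) = (c : N) * (h * n * h⁻¹) := hc
          have := congrArg (fun t => h⁻¹ * t * h) hc'
          simpa [mul_assoc] using this)⟩
      map_one' := Subtype.ext (Subtype.ext (by simp))
      map_mul' := fun a b => Subtype.ext (Subtype.ext (by simp [mul_assoc])) }
  have hzmul : ∀ g h, z (g * h) = conjZ h (z g) * z h := fun g h =>
    Subtype.ext (Subtype.ext (by simp [z, conjZ, mul_assoc]))
  have hzN : ∀ g, ∀ n ∈ N, z (g * n) = z g := fun g n hn =>
    Subtype.ext (Subtype.ext (by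
      have := hcentral g n hn
      simp only [z, map_mul, hN n hn, mul_inv_rev]
      rw [mul_assoc, ← mul_assoc g⁻¹, ← this]
      simp))
  let zbar : G ⧸ N → Subgroup.center N := Quotient.lift z fun g g' h => by
    have := hzN g _ (QuotientGroup.leftRel_apply.1 h)
    simpa using this.symm
  let a : Subgroup.center N := ∏ x, zbar x
  have ha : ∀ h, a = conjZ h a * z h ^ N.index := by
    intro h
    have hstep : ∀ x : G ⧸ N, zbar (x * h) = conjZ h (zbar x) * z h := by
      intro x
      induction x using QuotientGroup.induction_on with
      | H x => exact hzmul x h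
    calc a = ∏ x : G ⧸ N, zbar (x * h) :=
          (Equiv.prod_comp (Equiv.mulRight (h : G ⧸ N)) zbar).symm
      _ = conjZ h a * z h ^ N.index := by
          simp only [hstep, Finset.prod_mul_distrib, Finset.prod_const, Finset.card_univ, a,
            map_prod, Subgroup.index, Nat.card_eq_fintype_card]
  obtain ⟨c, hc⟩ : ∃ c : ℕ, ∀ h, (z h ^ N.index) ^ c = z h := by
    obtain ⟨c, -, hc⟩ := Nat.exists_mul_mod_eq_of_coprime 1
      (Nat.Coprime.pow_right k ((Nat.Prime.coprime_iff_not_dvd hp).2 hind).symm)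
      (pow_ne_zero k hp.ne_zero)
    refine ⟨c, fun h => ?_⟩
    rw [← pow_mul, pow_eq_pow_of_modEq hc (hzpow h), pow_one]
  have hac : ∀ h, a ^ c = conjZ h (a ^ c) * z h := fun h => by
    conv_lhs => rw [ha h]
    rw [mul_pow, hc, map_pow]
  refine ⟨((a ^ c : Subgroup.center N) : N)⁻¹, ?_⟩
  ext h
  have hh := congrArg (fun t : Subgroup.center N => ((t : N) : G)) (hac h)
  set b : Subgroup.center N := a ^ c
  have hb : ((b : N) : G) = h⁻¹ * (b : N) * h * (h⁻¹ * φ h) := hh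
  simp only [MulAut.conj_apply, inv_inv]
  rw [mul_assoc, inv_mul_eq_iff_eq_mul]
  have := congrArg (fun t => h * t) hb
  simpa [mul_assoc] using this

end Restriction

theorem exists_pow_mul_not_dvd_pow_eq_one {M : Type*} [Group M] [Finite M] {p : ℕ}
    (hp : p.Prime) (x : M) : ∃ k m : ℕ, ¬ p ∣ m ∧ (x ^ m) ^ p ^ k = 1 := by
  obtain ⟨k, m, hm, h⟩ := Nat.exists_eq_pow_mul_and_not_dvd (orderOf_pos x).ne' p hp.ne_one
  exact ⟨k, m, hm, by rw [← pow_mul, mul_comm, ← h, pow_orderOf_eq_one]⟩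

theorem mem_of_pow_mem_of_pow_prime_pow_eq_one {M : Type*} [Group M] {H : Subgroup M} {p k m : ℕ}
    (hp : p.Prime) (hm : ¬ p ∣ m) {x : M} (hx : x ^ p ^ k = 1) (hxm : x ^ m ∈ H) : x ∈ H := by
  have hcop : m.Coprime (orderOf x) :=
    (Nat.Coprime.pow_right k ((Nat.Prime.coprime_iff_not_dvd hp).2 hm).symm).coprime_dvd_right
      (orderOf_dvd_of_pow_eq_one hx)
  obtain ⟨c, hc⟩ := exists_pow_eq_self_of_coprime hcop
  exact hc ▸ H.pow_mem hxm c

/-- If `N ⊴ G` has index coprime to `p` and `p` does not divide the order of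
`Out_c(N) ∩ Out_Col(N)`, then `p` does not divide the order of `Out_c(G) ∩ Out_Col(G)`. -/
theorem stmt_5 (G : Type*) [Group G] [Finite G] (N : Subgroup G) (hN : N.Normal)
    (p : ℕ) (hp : p.Prime) (hind : ¬ p ∣ N.index)
    (h : ¬ p ∣ Nat.card (OutCCol N)) :
    ¬ p ∣ Nat.card (OutCCol G) := by
  have hfin : Finite (MulAut G) := Finite.of_injective _ DFunLike.coe_injective
  rw [not_dvd_card_OutCCol_iff hp] at h ⊢
  intro φ hφ
  obtain ⟨k, m, hm, hk⟩ := exists_pow_mul_not_dvd_pow_eq_one hp φ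
  refine ⟨m, hm, ?_⟩
  generalize hα : φ ^ m = α at hk ⊢
  obtain ⟨hc, hcol⟩ : α ∈ classPresColemanAut G := hα ▸ pow_mem hφ m
  obtain ⟨m', hm', hinn⟩ := h _ (hc.restrict_mem_classPresColemanAut hp hind hcol hk)
  obtain ⟨n, hn⟩ : (hc.restrict : MulAut N) ∈ InnAut N :=
    mem_of_pow_mem_of_pow_prime_pow_eq_one (k := k) hp hm'
      (MulEquiv.ext fun u => Subtype.ext (by rw [hc.coe_restrict_pow_apply, hk]; rfl)) hinn
  have hconj : MulAut.conj (n : G) ∈ InnAut G := ⟨n, rfl⟩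
  have hβN : ∀ u ∈ N, ((MulAut.conj (n : G))⁻¹ * α) u = u := by
    intro u hu
    have hu' : (n : G) * u * (n : G)⁻¹ = α u :=
      congrArg Subtype.val (DFunLike.congr_fun hn (⟨u, hu⟩ : N))
    rw [MulAut.mul_apply, ← hu', ← MulAut.conj_apply, MulAut.inv_apply_self]
  have hβ : (MulAut.conj (n : G))⁻¹ * α ∈ classPresColemanAut G :=
    mul_mem (inv_mem (InnAut_le_classPresColemanAut G hconj)) ⟨hc, hcol⟩
  have hquot : (((MulAut.conj (n : G))⁻¹ * α : MulAut G) : MulAut G ⧸ InnAut G) = α := by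
    rw [QuotientGroup.mk_mul, (QuotientGroup.eq_one_iff _).2 (inv_mem hconj), one_mul]
  generalize (MulAut.conj (n : G))⁻¹ * α = β at hβN hβ hquot
  obtain ⟨l, r, hr, hl⟩ := exists_pow_mul_not_dvd_pow_eq_one hp β
  have hβr : β ^ r ∈ InnAut G :=
    mem_InnAut_of_trivial_on_of_trivial_mod hp hind hl
      (IsClassPres.inv_mul_apply_mem hp hind (pow_mem hβ r).1 hl) fun u hu => by
        clear hr hl
        induction r with
        | zero => rfl
        | succ r ih => rw [pow_succ, MulAut.mul_apply, hβN u hu, ih]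
  refine mem_of_pow_mem_of_pow_prime_pow_eq_one hp hr hk ?_
  rw [← QuotientGroup.eq_one_iff, QuotientGroup.mk_pow, ← hquot, ← QuotientGroup.mk_pow,
    QuotientGroup.eq_one_iff]
  exact hβr
end

section
/- Let p be a prime and G a finite group. Suppose φ is a non-inner automorphism of G whose order is a power of p, such that φ(g) is conjugate to g for every element g ∈ G of p-power order, and such that for every nontrivial normal subgroup N of G with φ(N) = N the automorphism induced by φ on G/N is inner. Then the Frattini subgroup Φ(G) of G is a p-group. -/
/-- A non-`p`-group that is finite and nilpotent has a nontrivial characteristic subgroup of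
order prime to `p`. -/
theorem exists_characteristic_coprime_card {H : Type*} [Group H] [Finite H] [Group.IsNilpotent H]
    {p : ℕ} (hp : p.Prime) (hH : ¬ IsPGroup p H) :
    ∃ N : Subgroup H, N.Characteristic ∧ N ≠ ⊥ ∧ ¬ p ∣ Nat.card N := by
  obtain ⟨q, hq, hqH, hqp⟩ : ∃ q, q.Prime ∧ q ∣ Nat.card H ∧ q ≠ p := by
    by_contra! h
    exact hH (IsPGroup.of_card
      (Nat.eq_prime_pow_of_unique_prime_dvd Nat.card_pos.ne' fun {d} hd hdH => h d hd hdH))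
  have : Fact q.Prime := ⟨hq⟩
  let Q : Sylow q H := default
  refine ⟨Q, Q.characteristic_of_normal inferInstance, Q.ne_bot_of_dvd_card hqH, fun hdvd => ?_⟩
  obtain ⟨n, hn⟩ := IsPGroup.iff_card.mp Q.isPGroup'
  rw [hn] at hdvd
  exact hqp ((Nat.prime_dvd_prime_iff_eq hp hq).mp (hp.dvd_of_dvd_pow hdvd)).symm

/-- Coprime action: an automorphism of `p`-power order stabilizing each coset of a subgroup of
order prime to `p` fixes an element of each coset. -/
theorem exists_mem_map_mul_eq_self {G : Type*} [Group G] [Finite G] {p a : ℕ} (hp : p.Prime)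
    {N : Subgroup G} (hN : ¬ p ∣ Nat.card N) {θ : MulAut G} (hθ : θ ^ p ^ a = 1)
    (hθN : ∀ g, θ g * g⁻¹ ∈ N) (g : G) : ∃ n ∈ N, θ (n * g) = n * g := by
  classical
  have : Fact p.Prime := ⟨hp⟩
  have : Fintype N := Fintype.ofFinite N
  let f : Function.End N := fun n => ⟨θ (n * g) * g⁻¹, by
    simpa [mul_assoc] using N.mul_mem (hθN (n * g)) n.2⟩
  have hf (j : ℕ) (n : N) : ((f ^ j) n : G) = (θ ^ j) (n * g) * g⁻¹ := by
    induction j with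
    | zero => simp [Function.End.one_def]
    | succ j ih =>
      rw [pow_succ', pow_succ', MulAut.mul_apply]
      change θ (((f ^ j) n : G) * g) * g⁻¹ = _
      rw [ih, inv_mul_cancel_right]
  have hf1 : f ^ p ^ a = 1 := by
    funext n
    exact Subtype.ext (by simp [hf, hθ, Function.End.one_def])
  have hcard := Equiv.Perm.card_fixedPoints_modEq hf1
  have hne : Nonempty f.fixedPoints := by
    rw [← Fintype.card_pos_iff, Nat.pos_iff_ne_zero]
    intro h0
    rw [h0, Nat.modEq_zero_iff_dvd, ← Nat.card_eq_fintype_card] at hcard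
    exact hN hcard
  obtain ⟨n, hn⟩ := hne
  refine ⟨n, n.2, ?_⟩
  have hn' : θ (n * g) * g⁻¹ = n := congrArg Subtype.val hn
  exact mul_inv_eq_iff_eq_mul.mp hn'

theorem MulAut.exists_conj_mul_pow_eq {G : Type*} [Group G] (x : G) (φ : MulAut G) (m : ℕ) :
    ∃ y, (MulAut.conj x * φ) ^ m = MulAut.conj y * φ ^ m := by
  induction m with
  | zero => exact ⟨1, by simp⟩
  | succ m ih =>
    obtain ⟨y, hy⟩ := ih
    refine ⟨y * (φ ^ m) x, ?_⟩
    rw [pow_succ, hy, pow_succ]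
    ext g
    simp [MulAut.mul_apply, mul_assoc]

theorem MulAut.pow_apply_mul_inv_mem {G : Type*} [Group G] {N : Subgroup G} {ψ : MulAut G}
    (h : ∀ g, ψ g * g⁻¹ ∈ N) (m : ℕ) (g : G) : (ψ ^ m) g * g⁻¹ ∈ N := by
  induction m with
  | zero => simp
  | succ m ih =>
    rw [pow_succ', MulAut.mul_apply]
    simpa [mul_assoc] using N.mul_mem (h ((ψ ^ m) g)) ih

/-- Every element of a finite group has a power of `p`-power order whose exponent is congruent
to `1` modulo a given power of `p`. -/
theorem exists_modEq_one_pow_pow_eq_one {M : Type*} [Group M] [Finite M] {p : ℕ} (hp : p.Prime)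
    (k : ℕ) (x : M) : ∃ m a : ℕ, m ≡ 1 [MOD p ^ k] ∧ (x ^ m) ^ p ^ a = 1 := by
  obtain ⟨a, r, hr, hx⟩ :=
    Nat.exists_eq_pow_mul_and_not_dvd (orderOf_pos x).ne' p hp.ne_one
  have hco : Nat.Coprime (p ^ k) r := ((hp.coprime_iff_not_dvd).mpr hr).pow_left k
  obtain ⟨m, hm1, hm0⟩ := Nat.chineseRemainder hco 1 0
  refine ⟨m, a, hm1, ?_⟩
  rw [← pow_mul, ← orderOf_dvd_iff_pow_eq_one, hx, mul_comm m]
  exact Nat.mul_dvd_mul_left _ (Nat.modEq_zero_iff_dvd.mp hm0)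

/-- An automorphism of `p`-power order is trivial if it acts trivially modulo a subgroup of the
Frattini subgroup of order prime to `p`. -/
theorem MulAut.eq_one_of_le_frattini {G : Type*} [Group G] [Finite G] {p a : ℕ} (hp : p.Prime)
    {N : Subgroup G} (hN : ¬ p ∣ Nat.card N) (hNf : N ≤ frattini G) {θ : MulAut G}
    (hθ : θ ^ p ^ a = 1) (hθN : ∀ g, θ g * g⁻¹ ∈ N) : θ = 1 := by
  let K : Subgroup G := θ.toMonoidHom.eqLocus (MonoidHom.id G)
  have hK : K ⊔ frattini G = ⊤ := by
    refine eq_top_iff.mpr fun g _ => ?_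
    obtain ⟨n, hn, hng⟩ := exists_mem_map_mul_eq_self hp hN hθ hθN g
    have hmem : n * g ∈ K := hng
    rw [← inv_mul_cancel_left n g]
    exact mul_mem (inv_mem (Subgroup.mem_sup_right (hNf hn))) (Subgroup.mem_sup_left hmem)
  ext g
  have hg : g ∈ K := frattini_nongenerating hK ▸ Subgroup.mem_top g
  exact hg

/-- Hertweck's lemma (i): if a finite group `G` has a non-inner automorphism of `p`-power
order preserving conjugacy classes of `p`-elements and inducing inner automorphisms on
all proper factor groups, then the Frattini subgroup of `G` is a `p`-group. -/
theorem stmt_7 (G : Type*) [Group G] [Finite G] (p : ℕ) (hp : p.Prime)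
    (φ : MulAut G) (hni : ¬ IsInnerAut φ) (hord : ∃ k : ℕ, orderOf φ = p ^ k)
    (hpcl : ∀ g : G, (∃ k : ℕ, g ^ (p ^ k) = 1) → IsConj g (φ g))
    (hquot : ∀ N : Subgroup G, N.Normal → N ≠ ⊥ → Subgroup.map φ.toMonoidHom N = N →
      ∃ x : G, ∀ g : G, φ g * (x⁻¹ * g * x)⁻¹ ∈ N) :
    IsPGroup p (frattini G) := by
  obtain ⟨k, hk⟩ := hord
  by_contra hΦ
  have := frattini_nilpotent (G := G)
  obtain ⟨N₀, hchar, hN₀, hcard⟩ := exists_characteristic_coprime_card hp hΦ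
  let N : Subgroup G := N₀.map (frattini G).subtype
  have hNchar : N.Characteristic := inferInstance
  have hNbot : N ≠ ⊥ := fun h =>
    hN₀ ((Subgroup.map_eq_bot_iff_of_injective _ (frattini G).subtype_injective).mp h)
  have hNcard : ¬ p ∣ Nat.card N := by
    rwa [Subgroup.card_map_of_injective (frattini G).subtype_injective]
  obtain ⟨x, hx⟩ := hquot N inferInstance hNbot
    (Subgroup.characteristic_iff_map_eq.mp hNchar φ)
  have hψ (g : G) : (MulAut.conj x * φ) g * g⁻¹ ∈ N := by
    have h := (inferInstance : N.Normal).conj_mem _ (hx g) x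
    simpa [MulAut.mul_apply, mul_assoc] using h
  obtain ⟨m, a, hm, hma⟩ := exists_modEq_one_pow_pow_eq_one hp k (MulAut.conj x * φ)
  have h1 := MulAut.eq_one_of_le_frattini hp hNcard (Subgroup.map_subtype_le N₀) hma
    (MulAut.pow_apply_mul_inv_mem hψ m)
  obtain ⟨y, hy⟩ := MulAut.exists_conj_mul_pow_eq x φ m
  rw [h1, pow_eq_pow_iff_modEq.mpr (hk ▸ hm), pow_one] at hy
  exact hni ⟨y⁻¹, by rw [map_inv, eq_inv_of_mul_eq_one_right hy.symm]⟩
end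

section
/- Let p be a prime and G a finite group. Suppose φ is a non-inner automorphism of G whose order is a power of p, such that φ(g) is conjugate to g for every element g ∈ G of p-power order, and such that for every nontrivial normal subgroup M of G with φ(M) = M the automorphism induced by φ on G/M is inner. Assume in addition that every normal p-subgroup of G is trivial (O_p(G) = 1), and let N be a nontrivial normal subgroup of G with C_G(N) ≤ N. Then for every g ∈ G there exists n ∈ N with φ(n) ≠ g⁻¹ * n * g; that is, the restriction of φ to N does not coincide with the restriction of any inner automorphism of G. -/
/-- The inner automorphisms form a normal subgroup of the automorphism group. -/
theorem MulAut.conj_range_normal (G : Type*) [Group G] :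
    (MulAut.conj : G →* MulAut G).range.Normal := by
  refine ⟨?_⟩
  rintro _ ⟨g, rfl⟩ ψ
  refine ⟨ψ g, ?_⟩
  ext x
  simp

/-- If a normal subgroup `N` contains its centralizer and `G` has no nontrivial normal
`p`-subgroup, then the order of the centralizer of `N` is prime to `p`. -/
theorem coprime_card_centralizer_of_le {G : Type*} [Group G] [Finite G] {p : ℕ} (hp : p.Prime)
    (hOp : ∀ M : Subgroup G, M.Normal → IsPGroup p M → M = ⊥)
    {N : Subgroup G} (hN : N.Normal) (hC : Subgroup.centralizer (N : Set G) ≤ N) :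
    p.Coprime (Nat.card (Subgroup.centralizer (N : Set G))) := by
  have : Fact p.Prime := ⟨hp⟩
  rw [hp.coprime_iff_not_dvd]
  intro hdvd
  obtain ⟨z, hz⟩ := exists_prime_orderOf_dvd_card' p hdvd
  have hcomm : ∀ a ∈ Subgroup.centralizer (N : Set G),
      ∀ b ∈ Subgroup.centralizer (N : Set G), Commute a b := fun a ha b hb =>
    (Subgroup.mem_centralizer_iff.mp hb) a (hC ha)
  let M : Subgroup G :=
    { carrier := {a | a ∈ Subgroup.centralizer (N : Set G) ∧ a ^ p = 1}
      mul_mem' := by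
        rintro a b ⟨ha, ha'⟩ ⟨hb, hb'⟩
        exact ⟨mul_mem ha hb, by rw [(hcomm a ha b hb).mul_pow, ha', hb', one_mul]⟩
      one_mem' := ⟨one_mem _, one_pow _⟩
      inv_mem' := by
        rintro a ⟨ha, ha'⟩
        exact ⟨inv_mem ha, by rw [inv_pow, ha', inv_one]⟩ }
  have hM : M = ⊥ := by
    refine hOp M ⟨?_⟩ ?_
    · rintro a ⟨ha, ha'⟩ g
      refine ⟨?_, by rw [conj_pow, ha', mul_one, mul_inv_cancel]⟩
      have : (Subgroup.centralizer (N : Set G)).Normal := inferInstance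
      exact this.conj_mem a ha g
    · rintro ⟨a, ha, ha'⟩
      exact ⟨1, Subtype.ext (by simpa using ha')⟩
  have hzp : (z : G) ^ p = 1 := by
    rw [← hz, ← Subgroup.orderOf_coe, pow_orderOf_eq_one]
  have hzM : (z : G) ∈ M := ⟨z.2, hzp⟩
  rw [hM, Subgroup.mem_bot] at hzM
  have hz1 : z = 1 := Subtype.ext hzM
  rw [hz1, orderOf_one] at hz
  exact hp.one_lt.ne hz

/-- An automorphism that fixes pointwise a normal subgroup `N` containing its centralizer has
order dividing the order of that centralizer. -/
theorem MulAut.pow_card_centralizer_eq_one {G : Type*} [Group G] {N : Subgroup G}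
    (hN : N.Normal) (hC : Subgroup.centralizer (N : Set G) ≤ N) {ψ : MulAut G}
    (hψ : ∀ n ∈ N, ψ n = n) :
    ψ ^ Nat.card (Subgroup.centralizer (N : Set G)) = 1 := by
  have hd : ∀ x, x⁻¹ * ψ x ∈ Subgroup.centralizer (N : Set G) := by
    intro x
    rw [Subgroup.mem_centralizer_iff]
    intro n hn
    have h := hψ _ (hN.conj_mem n hn x)
    rw [map_mul, map_mul, map_inv, hψ n hn] at h
    have h' : ψ x * n = x * n * x⁻¹ * ψ x := by rw [← h]; group
    rw [mul_assoc x⁻¹, h']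
    group
  have hpow : ∀ (k : ℕ) (x : G), (ψ ^ k) x = x * (x⁻¹ * ψ x) ^ k := by
    intro k x
    induction k with
    | zero => simp
    | succ k ih =>
      rw [pow_succ', MulAut.mul_apply, ih, map_mul, map_pow, hψ _ (hC (hd x)), pow_succ', mul_assoc,
        mul_inv_cancel_left]
  ext x
  have h := congrArg Subtype.val
    (pow_card_eq_one' (x := (⟨_, hd x⟩ : Subgroup.centralizer (N : Set G))))
  rw [hpow, MulAut.one_apply]
  simp only [SubmonoidClass.mk_pow, OneMemClass.coe_one] at h
  rw [h, mul_one]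

/-- Hertweck's lemma (iii): under the hypotheses of Lemma 5, if `O_p(G) = 1` and `N` is a
nontrivial normal subgroup with `C_G(N) ≤ N`, then the restriction of `φ` to `N` does not
coincide with the restriction of any inner automorphism of `G`. -/
theorem stmt_9 (G : Type*) [Group G] [Finite G] (p : ℕ) (hp : p.Prime)
    (φ : MulAut G) (hni : ¬ IsInnerAut φ) (hord : ∃ k : ℕ, orderOf φ = p ^ k)
    (hpcl : ∀ g : G, (∃ k : ℕ, g ^ (p ^ k) = 1) → IsConj g (φ g))
    (hquot : ∀ M : Subgroup G, M.Normal → M ≠ ⊥ → Subgroup.map φ.toMonoidHom M = M →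
      ∃ x : G, ∀ g : G, φ g * (x⁻¹ * g * x)⁻¹ ∈ M)
    (hOp : ∀ M : Subgroup G, M.Normal → IsPGroup p M → M = ⊥)
    (N : Subgroup G) (hN : N.Normal) (hNnt : N ≠ ⊥)
    (hC : Subgroup.centralizer (N : Set G) ≤ N) :
    ∀ g : G, ∃ n ∈ N, φ n ≠ g⁻¹ * n * g := by
  intro g
  by_contra! hcon
  obtain ⟨k, hk⟩ := hord
  have := MulAut.conj_range_normal G
  let π := QuotientGroup.mk' (MulAut.conj : G →* MulAut G).range
  have hψ := MulAut.pow_card_centralizer_eq_one hN hC (ψ := MulAut.conj g * φ) fun n hn => by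
    rw [MulAut.mul_apply, hcon n hn, MulAut.conj_apply]
    group
  have hconj : π (MulAut.conj g) = 1 := (QuotientGroup.eq_one_iff _).mpr ⟨g, rfl⟩
  have hcard : π φ ^ Nat.card (Subgroup.centralizer (N : Set G)) = 1 := by
    simpa [hconj] using congrArg π hψ
  have hppow : π φ ^ p ^ k = 1 := by
    rw [← map_pow, ← hk, pow_orderOf_eq_one, map_one]
  have hone : π φ = 1 := by
    rw [← pow_one (π φ), ← ((coprime_card_centralizer_of_le hp hOp hN hC).pow_left k).gcd_eq_one]
    exact pow_gcd_eq_one.mpr ⟨hppow, hcard⟩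
  obtain ⟨x, hx⟩ := (QuotientGroup.eq_one_iff _).mp hone
  exact hni ⟨x, hx.symm⟩
end
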